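/- arXiv:math/0606781 — 2 statements merged into one kernel-verified Lean document; each statement's English description precedes it below -/
import Mathlib

section
/- Let 0 < q < 1 be a real number, let u be a nonzero complex number, and let λ ∈ [0,1) be a real number. Then there exists a positive integer M such that for every integer m ≥ M, | Σ_{k=0}^{m} (q^{m−k+1};q)_∞ · q^{k²/2} · (u^{−1} q^{λ})^k − Σ_{k=0}^{∞} q^{k²/2} (u^{−1} q^{λ})^k | ≤ (2·(−q;q)_∞ · θ(|u|^{−1} q^{λ}; q) / (1−q)) · ( q^{m/2} + q^{m²/8} / |u|^{⌊m/2⌋+1} ), where powers of q with real exponents denote real powers. -/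
/-- The real infinite q-Pochhammer symbol `(a;q)_∞ = ∏_{j=0}^∞ (1 - a qʲ)`. -/
noncomputable def qPochInfR (a q : ℝ) : ℝ := ∏' j : ℕ, (1 - a * q ^ j)

/-- The theta function `θ(x;q) = Σ_{k=-∞}^∞ q^{k²/2} xᵏ` for real `x ≠ 0`. -/
noncomputable def thetaR (x q : ℝ) : ℝ := ∑' k : ℤ, q ^ ((k : ℝ) ^ 2 / 2) * x ^ k

open Filter Topology

theorem multipliable_one_sub_mul_pow {q : ℝ} (hq0 : 0 < q) (hq1 : q < 1) (a : ℝ) :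
    Multipliable fun j : ℕ => 1 - a * q ^ j := by
  have h : Summable fun j : ℕ => -(a * q ^ j) :=
    ((summable_geometric_of_lt_one hq0.le hq1).mul_left a).neg
  simpa [sub_eq_add_neg] using Real.multipliable_one_add_of_summable h

theorem one_sub_sum_le_prod_one_sub {f : ℕ → ℝ} (h0 : ∀ j, 0 ≤ f j) (h1 : ∀ j, f j ≤ 1)
    (n : ℕ) : 1 - ∑ j ∈ Finset.range n, f j ≤ ∏ j ∈ Finset.range n, (1 - f j) := by
  induction n with
  | zero => simp
  | succ n ih =>
    rw [Finset.sum_range_succ, Finset.prod_range_succ]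
    have hle : ∏ j ∈ Finset.range n, (1 - f j) ≤ 1 :=
      Finset.prod_le_one (fun j _ => by linarith [h1 j]) fun j _ => by linarith [h0 j]
    nlinarith [h0 n, h1 n]

theorem qPochInfR_mem_Icc {q a : ℝ} (hq0 : 0 < q) (hq1 : q < 1) (ha0 : 0 ≤ a) (ha1 : a ≤ 1) :
    qPochInfR a q ∈ Set.Icc (0 : ℝ) 1 := by
  have hb : ∀ j : ℕ, 0 ≤ a * q ^ j := fun j => by positivity
  have hb1 : ∀ j : ℕ, a * q ^ j ≤ 1 := fun j =>
    mul_le_one₀ ha1 (by positivity) (pow_le_one₀ hq0.le hq1.le)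
  have ht := (multipliable_one_sub_mul_pow hq0 hq1 a).hasProd.tendsto_prod_nat
  exact isClosed_Icc.mem_of_tendsto ht (Eventually.of_forall fun n =>
    ⟨Finset.prod_nonneg fun j _ => by linarith [hb1 j],
      Finset.prod_le_one (fun j _ => by linarith [hb1 j]) fun j _ => by linarith [hb j]⟩)

theorem one_sub_div_le_qPochInfR {q a : ℝ} (hq0 : 0 < q) (hq1 : q < 1) (ha0 : 0 ≤ a)
    (ha1 : a ≤ 1) : 1 - a / (1 - q) ≤ qPochInfR a q := by
  have hb1 : ∀ j : ℕ, a * q ^ j ≤ 1 := fun j =>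
    mul_le_one₀ ha1 (by positivity) (pow_le_one₀ hq0.le hq1.le)
  have ht := (multipliable_one_sub_mul_pow hq0 hq1 a).hasProd.tendsto_prod_nat
  have hs := ((hasSum_geometric_of_lt_one hq0.le hq1).mul_left a).tendsto_sum_nat
  rw [div_eq_mul_inv]
  exact le_of_tendsto_of_tendsto' (hs.const_sub 1) ht
    (one_sub_sum_le_prod_one_sub (fun j => by positivity) hb1)

theorem one_le_tprod_one_add_pow {q : ℝ} (hq0 : 0 < q) (hq1 : q < 1) :
    1 ≤ ∏' j : ℕ, (1 + q ^ (j + 1)) := by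
  have h : Multipliable fun j : ℕ => 1 + q ^ (j + 1) :=
    Real.multipliable_one_add_of_summable
      ((summable_nat_add_iff 1).2 (summable_geometric_of_lt_one hq0.le hq1))
  refine ge_of_tendsto' h.hasProd.tendsto_prod_nat fun n => ?_
  simpa using Finset.prod_le_prod (s := Finset.range n) (f := fun _ => (1 : ℝ))
    (fun _ _ => zero_le_one) fun j _ => by linarith [pow_pos hq0 (j + 1)]

theorem summable_gaussian_mul_pow {q x : ℝ} (hq0 : 0 < q) (hq1 : q < 1) (hx : 0 < x) :
    Summable fun k : ℕ => q ^ ((k : ℝ) ^ 2 / 2) * x ^ k := by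
  refine summable_of_ratio_test_tendsto_lt_one (l := 0) one_pos
    (Eventually.of_forall fun k => by positivity) ?_
  have h : Tendsto (fun k : ℕ => q ^ k * (q ^ (1 / 2 : ℝ) * x)) atTop (𝓝 0) := by
    simpa using (tendsto_pow_atTop_nhds_zero_of_lt_one hq0.le hq1).mul_const
      (q ^ (1 / 2 : ℝ) * x)
  refine h.congr fun k => ?_
  have hk : q ^ (((k + 1 : ℕ) : ℝ) ^ 2 / 2) =
      q ^ ((k : ℝ) ^ 2 / 2) * q ^ k * q ^ (1 / 2 : ℝ) := by
    rw [← Real.rpow_natCast q k, ← Real.rpow_add hq0, ← Real.rpow_add hq0]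
    congr 1
    push_cast
    ring
  rw [Real.norm_of_nonneg (by positivity), Real.norm_of_nonneg (by positivity), hk, pow_succ]
  field_simp
  ring

theorem tsum_nat_le_thetaR {q x : ℝ} (hq0 : 0 < q) (hq1 : q < 1) (hx : 0 < x) :
    ∑' k : ℕ, q ^ ((k : ℝ) ^ 2 / 2) * x ^ k ≤ thetaR x q := by
  have hs : Summable fun k : ℤ => q ^ ((k : ℝ) ^ 2 / 2) * x ^ k := by
    refine Summable.of_nat_of_neg ?_ ?_
    · simpa using summable_gaussian_mul_pow hq0 hq1 hx
    · simpa using summable_gaussian_mul_pow hq0 hq1 (inv_pos.2 hx)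
  simpa [thetaR, Function.comp_def] using
    tsum_comp_le_tsum_of_inj hs (fun k => by positivity) (Nat.cast_injective (R := ℤ))

theorem gaussian_mul_pow_add_le {q r lam : ℝ} (hq0 : 0 < q) (hq1 : q < 1) (hr : 0 < r)
    (hlam : 0 ≤ lam) {m N : ℕ} (hmN : m ≤ 2 * N) (j : ℕ) :
    q ^ (((j + N : ℕ) : ℝ) ^ 2 / 2) * (r⁻¹ * q ^ lam) ^ (j + N) ≤
      q ^ ((m : ℝ) ^ 2 / 8) / r ^ N * (q ^ ((j : ℝ) ^ 2 / 2) * (r⁻¹ * q ^ lam) ^ j) := by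
  have hm : (m : ℝ) ≤ 2 * N := by exact_mod_cast hmN
  have hexp : q ^ (((j + N : ℕ) : ℝ) ^ 2 / 2) ≤
      q ^ ((m : ℝ) ^ 2 / 8) * q ^ ((j : ℝ) ^ 2 / 2) := by
    rw [← Real.rpow_add hq0]
    refine Real.rpow_le_rpow_of_exponent_ge hq0 hq1.le ?_
    have : (0 : ℝ) ≤ (j : ℝ) * N := by positivity
    push_cast
    nlinarith [(Nat.cast_nonneg m : (0 : ℝ) ≤ m)]
  have hpow : (r⁻¹ * q ^ lam) ^ (j + N) ≤ (r ^ N)⁻¹ * (r⁻¹ * q ^ lam) ^ j := by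
    rw [pow_add, mul_comm, mul_pow _ _ N, inv_pow]
    gcongr
    exact mul_le_of_le_one_right (by positivity)
      (pow_le_one₀ (by positivity) (Real.rpow_le_one hq0.le hq1.le hlam))
  calc _ ≤ q ^ ((m : ℝ) ^ 2 / 8) * q ^ ((j : ℝ) ^ 2 / 2) *
        ((r ^ N)⁻¹ * (r⁻¹ * q ^ lam) ^ j) := by gcongr
    _ = _ := by ring

/-- For `0 < q < 1`, nonzero complex `u` and `λ ∈ [0,1)`, there is `M ≥ 1` such that
for all `m ≥ M`,
`|Σ_{k=0}^m (q^{m-k+1};q)_∞ q^{k²/2} (u⁻¹ q^λ)^k − Σ_{k=0}^∞ q^{k²/2} (u⁻¹ q^λ)^k|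
  ≤ (2 (-q;q)_∞ θ(|u|⁻¹ q^λ;q)/(1-q)) (q^{m/2} + q^{m²/8}/|u|^{⌊m/2⌋+1})`. -/
theorem partial_sum_theta_bound (q : ℝ) (hq0 : 0 < q) (hq1 : q < 1) (u : ℂ) (hu : u ≠ 0)
    (lam : ℝ) (hlam : lam ∈ Set.Ico (0 : ℝ) 1) :
    ∃ M : ℕ, 0 < M ∧ ∀ m : ℕ, M ≤ m →
      ‖(∑ k ∈ Finset.range (m + 1),
          ((qPochInfR (q ^ (m - k + 1)) q : ℝ) : ℂ) * ((q ^ ((k : ℝ) ^ 2 / 2) : ℝ) : ℂ) *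
            (u⁻¹ * ((q ^ lam : ℝ) : ℂ)) ^ k) -
        ∑' k : ℕ, ((q ^ ((k : ℝ) ^ 2 / 2) : ℝ) : ℂ) * (u⁻¹ * ((q ^ lam : ℝ) : ℂ)) ^ k‖ ≤
      2 * (∏' j : ℕ, (1 + q ^ (j + 1))) * thetaR (‖u‖⁻¹ * q ^ lam) q / (1 - q) *
        (q ^ ((m : ℝ) / 2) + q ^ ((m : ℝ) ^ 2 / 8) / ‖u‖ ^ (m / 2 + 1)) := by
  refine ⟨1, one_pos, fun m _ => ?_⟩
  have hr : 0 < ‖u‖ := norm_pos_iff.2 hu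
  set x : ℝ := ‖u‖⁻¹ * q ^ lam with hx_def
  have hx : 0 < x := by positivity
  set a : ℕ → ℝ := fun k => q ^ ((k : ℝ) ^ 2 / 2) * x ^ k with ha_def
  have ha0 : ∀ k, 0 ≤ a k := fun k => by positivity
  have ha : Summable a := summable_gaussian_mul_pow hq0 hq1 hx
  set b : ℕ → ℂ := fun k =>
    ((q ^ ((k : ℝ) ^ 2 / 2) : ℝ) : ℂ) * (u⁻¹ * ((q ^ lam : ℝ) : ℂ)) ^ k with hb_def
  have hb : ∀ k, ‖b k‖ = a k := fun k => by
    simp only [hb_def, ha_def, hx_def, norm_mul, norm_pow, norm_inv, Complex.norm_real,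
      Real.norm_of_nonneg (Real.rpow_nonneg hq0.le _)]
  have hbs : Summable b := .of_norm (by simpa only [hb] using ha)
  set c : ℕ → ℝ := fun k => if k < m + 1 then qPochInfR (q ^ (m - k + 1)) q else 0 with hc_def
  have hc : ∀ k, ‖c k - 1‖ ≤ 1 := fun k => by
    rw [Real.norm_eq_abs, abs_le]
    simp only [hc_def]
    split_ifs
    · obtain ⟨h0, h1⟩ := qPochInfR_mem_Icc hq0 hq1 (pow_nonneg hq0.le (m - k + 1))
        (pow_le_one₀ hq0.le hq1.le)
      constructor <;> linarith
    · norm_num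
  have hc' : ∀ k < m / 2 + 1, ‖c k - 1‖ ≤ q ^ ((m : ℝ) / 2) / (1 - q) := fun k hk => by
    have hkm : k < m + 1 := by omega
    have hp0 := pow_nonneg hq0.le (m - k + 1)
    have hp1 : q ^ (m - k + 1) ≤ 1 := pow_le_one₀ hq0.le hq1.le
    have hlow := one_sub_div_le_qPochInfR hq0 hq1 hp0 hp1
    have hle := (qPochInfR_mem_Icc hq0 hq1 hp0 hp1).2
    have hpow : q ^ (m - k + 1) ≤ q ^ ((m : ℝ) / 2) := by
      rw [← Real.rpow_natCast]
      refine Real.rpow_le_rpow_of_exponent_ge hq0 hq1.le ?_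
      have : (m : ℝ) ≤ 2 * ((m - k + 1 : ℕ) : ℝ) := by
        exact_mod_cast (by omega : m ≤ 2 * (m - k + 1))
      linarith
    have hdiv : q ^ (m - k + 1) / (1 - q) ≤ q ^ ((m : ℝ) / 2) / (1 - q) :=
      div_le_div_of_nonneg_right hpow (by linarith)
    simp only [hc_def, if_pos hkm]
    rw [Real.norm_eq_abs, abs_of_nonpos (by linarith)]
    linarith
  have hf : ∀ k, ‖((c k - 1 : ℝ) : ℂ) * b k‖ = ‖c k - 1‖ * a k := fun k => by
    rw [norm_mul, hb, Complex.norm_real]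
  have hfs : Summable fun k => ((c k - 1 : ℝ) : ℂ) * b k :=
    .of_norm_bounded ha fun k => by
      rw [hf]
      exact mul_le_of_le_one_left (ha0 k) (hc k)
  have hdiff : (∑ k ∈ Finset.range (m + 1),
      ((qPochInfR (q ^ (m - k + 1)) q : ℝ) : ℂ) * ((q ^ ((k : ℝ) ^ 2 / 2) : ℝ) : ℂ) *
        (u⁻¹ * ((q ^ lam : ℝ) : ℂ)) ^ k) - ∑' k, b k =
      ∑' k, ((c k - 1 : ℝ) : ℂ) * b k := by
    have hsupp : ∀ k ∉ Finset.range (m + 1), (c k : ℂ) * b k = 0 := fun k hk => by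
      simp only [hc_def, if_neg (Finset.mem_range.not.1 hk), Complex.ofReal_zero, zero_mul]
    have hcs : Summable fun k => (c k : ℂ) * b k :=
      summable_of_ne_finset_zero (s := Finset.range (m + 1)) hsupp
    have hcb : ∑' k, (c k : ℂ) * b k = ∑ k ∈ Finset.range (m + 1),
        ((qPochInfR (q ^ (m - k + 1)) q : ℝ) : ℂ) * ((q ^ ((k : ℝ) ^ 2 / 2) : ℝ) : ℂ) *
          (u⁻¹ * ((q ^ lam : ℝ) : ℂ)) ^ k := by
      rw [tsum_eq_sum hsupp]
      refine Finset.sum_congr rfl fun k hk => ?_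
      simp only [hc_def, hb_def, if_pos (Finset.mem_range.1 hk), mul_assoc]
    rw [← hcb, ← hcs.tsum_sub hbs]
    refine tsum_congr fun k => ?_
    push_cast
    ring
  have hT : ∑' k, a k ≤ thetaR x q := tsum_nat_le_thetaR hq0 hq1 hx
  have hT0 : 0 ≤ ∑' k, a k := tsum_nonneg ha0
  have hq : 0 < 1 - q := by linarith
  set e : ℝ := q ^ ((m : ℝ) ^ 2 / 8) / ‖u‖ ^ (m / 2 + 1) with he_def
  have he0 : 0 ≤ e := by positivity
  have hd0 : 0 ≤ q ^ ((m : ℝ) / 2) := by positivity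
  have hhead : ‖∑ k ∈ Finset.range (m / 2 + 1), ((c k - 1 : ℝ) : ℂ) * b k‖ ≤
      q ^ ((m : ℝ) / 2) / (1 - q) * ∑' k, a k := by
    refine (norm_sum_le _ _).trans ?_
    calc _ ≤ ∑ k ∈ Finset.range (m / 2 + 1), q ^ ((m : ℝ) / 2) / (1 - q) * a k :=
          Finset.sum_le_sum fun k hk => by
            rw [hf]
            exact mul_le_mul_of_nonneg_right (hc' k (Finset.mem_range.1 hk)) (ha0 k)
      _ ≤ _ := by
          rw [← Finset.mul_sum]
          exact mul_le_mul_of_nonneg_left (ha.sum_le_tsum _ fun k _ => ha0 k) (by positivity)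
  have htail : ‖∑' j, ((c (j + (m / 2 + 1)) - 1 : ℝ) : ℂ) * b (j + (m / 2 + 1))‖ ≤
      e * ∑' k, a k := by
    refine tsum_of_norm_bounded (ha.hasSum.mul_left e) fun j => ?_
    rw [hf]
    exact (mul_le_of_le_one_left (ha0 _) (hc _)).trans
      (gaussian_mul_pow_add_le hq0 hq1 hr hlam.1 (by omega) j)
  have hP := one_le_tprod_one_add_pow hq0 hq1
  rw [hdiff, ← hfs.sum_add_tsum_nat_add (m / 2 + 1)]
  refine (norm_add_le _ _).trans ((add_le_add hhead htail).trans ?_)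
  have he : e ≤ e / (1 - q) := le_div_self he0 hq (by linarith)
  calc _ ≤ q ^ ((m : ℝ) / 2) / (1 - q) * ∑' k, a k + e / (1 - q) * ∑' k, a k := by gcongr
    _ = 1 * (∑' k, a k) / (1 - q) * (q ^ ((m : ℝ) / 2) + e) := by ring
    _ ≤ _ := by
        gcongr
        linarith
end

section
/- Let 0 < q < 1 be a real number, let u be a nonzero complex number, let λ ∈ [0,1) be a real number, and let m ≥ 0 be an integer. Then Σ_{k=1}^{∞} (q^{m+k+1};q)_∞ · q^{k²/2} · (u q^{−λ})^k = Σ_{k=−∞}^{−1} q^{k²/2} (u^{−1} q^{λ})^k + r, where |r| ≤ q^{m+2} · (−q³;q)_∞ · θ(|u|^{−1} q^{λ}; q) / (1 − q), and powers of q with real exponents denote real powers. -/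
/-- Bernoulli-type bounds for the infinite `q`-Pochhammer symbol:
`1 - a / (1 - q) ≤ (a;q)_∞ ≤ 1` for `0 ≤ a ≤ 1`. -/
lemma qPochInfR_bounds {a q : ℝ} (ha0 : 0 ≤ a) (ha1 : a ≤ 1) (hq0 : 0 ≤ q) (hq1 : q < 1) :
    1 - a / (1 - q) ≤ qPochInfR a q ∧ qPochInfR a q ≤ 1 := by
  have hsum : HasSum (fun j : ℕ => a * q ^ j) (a / (1 - q)) := by
    simpa [div_eq_mul_inv] using (hasSum_geometric_of_lt_one hq0 hq1).mul_left a
  have hterm0 (j : ℕ) : 0 ≤ a * q ^ j := by positivity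
  have hterm1 (j : ℕ) : a * q ^ j ≤ 1 :=
    mul_le_one₀ ha1 (by positivity) (pow_le_one₀ hq0 hq1.le)
  have hmul : Multipliable fun j : ℕ => 1 - a * q ^ j := by
    simpa [sub_eq_add_neg] using Real.multipliable_one_add_of_summable hsum.summable.neg
  have hfin (n : ℕ) : 1 - ∑ j ∈ Finset.range n, a * q ^ j ≤
        ∏ j ∈ Finset.range n, (1 - a * q ^ j) ∧
      ∏ j ∈ Finset.range n, (1 - a * q ^ j) ≤ 1 := by
    have hle (n : ℕ) : ∏ j ∈ Finset.range n, (1 - a * q ^ j) ≤ 1 :=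
      Finset.prod_le_one (fun j _ => sub_nonneg.2 (hterm1 j))
        fun j _ => sub_le_self _ (hterm0 j)
    refine ⟨?_, hle n⟩
    induction n with
    | zero => simp
    | succ n ih =>
      rw [Finset.sum_range_succ, Finset.prod_range_succ]
      nlinarith [mul_le_mul_of_nonneg_right (hle n) (hterm0 n)]
  have hlim := hmul.hasProd.tendsto_prod_nat
  refine ⟨ge_of_tendsto' hlim fun n => le_trans ?_ (hfin n).1,
    le_of_tendsto' hlim fun n => (hfin n).2⟩
  exact sub_le_sub_left (sum_le_hasSum _ (fun j _ => hterm0 j) hsum) 1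

/-- The one-sided theta series converges. -/
lemma summable_nat_theta_term {x q : ℝ} (hx : 0 < x) (hq0 : 0 < q) (hq1 : q < 1) :
    Summable fun n : ℕ => q ^ ((n : ℝ) ^ 2 / 2) * x ^ n := by
  refine summable_of_ratio_test_tendsto_lt_one (l := 0) one_pos
    (Filter.Eventually.of_forall fun n => by positivity) ?_
  have hratio (n : ℕ) : ‖q ^ (((n + 1 : ℕ) : ℝ) ^ 2 / 2) * x ^ (n + 1)‖ /
      ‖q ^ ((n : ℝ) ^ 2 / 2) * x ^ n‖ = q ^ n * (q ^ (1 / 2 : ℝ) * x) := by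
    have hexp : q ^ (((n + 1 : ℕ) : ℝ) ^ 2 / 2) =
        q ^ ((n : ℝ) ^ 2 / 2) * (q ^ n * q ^ (1 / 2 : ℝ)) := by
      rw [← Real.rpow_natCast q n, ← Real.rpow_add hq0, ← Real.rpow_add hq0]
      congr 1
      push_cast
      ring
    rw [Real.norm_of_nonneg (by positivity), Real.norm_of_nonneg (by positivity), hexp]
    field_simp
    ring
  simp_rw [hratio]
  simpa using (tendsto_pow_atTop_nhds_zero_of_lt_one hq0.le hq1).mul_const (q ^ (1 / 2 : ℝ) * x)

/-- The doubly infinite theta series converges. -/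
lemma summable_int_theta_term {x q : ℝ} (hx : 0 < x) (hq0 : 0 < q) (hq1 : q < 1) :
    Summable fun k : ℤ => q ^ ((k : ℝ) ^ 2 / 2) * x ^ k := by
  refine Summable.of_nat_of_neg ?_ ?_
  · simpa using summable_nat_theta_term hx hq0 hq1
  · simpa using summable_nat_theta_term (inv_pos.2 hx) hq0 hq1

/-- For `0 < q < 1`, nonzero complex `u`, `λ ∈ [0,1)` and `m ≥ 0`,
`Σ_{k=1}^∞ (q^{m+k+1};q)_∞ q^{k²/2} (u q^{-λ})^k = Σ_{k=-∞}^{-1} q^{k²/2} (u⁻¹ q^λ)^k + r`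
with `|r| ≤ q^{m+2} (-q³;q)_∞ θ(|u|⁻¹ q^λ;q)/(1-q)`.
The sum over `k ≥ 1` is indexed by `k = j + 1`, and the sum over negative `k` is indexed by
`k = -(j+1)`, with `j : ℕ`. -/
theorem tail_sum_eq_neg_theta_part (q : ℝ) (hq0 : 0 < q) (hq1 : q < 1) (u : ℂ) (hu : u ≠ 0)
    (lam : ℝ) (hlam : lam ∈ Set.Ico (0 : ℝ) 1) (m : ℕ) :
    ∃ r : ℂ,
      (∑' j : ℕ, ((qPochInfR (q ^ (m + j + 2)) q : ℝ) : ℂ) *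
          ((q ^ (((j : ℝ) + 1) ^ 2 / 2) : ℝ) : ℂ) * (u * ((q ^ (-lam) : ℝ) : ℂ)) ^ (j + 1)) =
        (∑' j : ℕ, ((q ^ (((j : ℝ) + 1) ^ 2 / 2) : ℝ) : ℂ) *
          (u⁻¹ * ((q ^ lam : ℝ) : ℂ)) ^ (-((j : ℤ) + 1))) + r ∧
      ‖r‖ ≤ q ^ (m + 2) * (∏' j : ℕ, (1 + q ^ (j + 3))) *
        thetaR (‖u‖⁻¹ * q ^ lam) q / (1 - q) := by
  set P : ℕ → ℝ := fun j => qPochInfR (q ^ (m + j + 2)) q with hP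
  set w : ℂ := u⁻¹ * ((q ^ lam : ℝ) : ℂ) with hw
  set x : ℝ := ‖u‖⁻¹ * q ^ lam with hx
  have hx0 : 0 < x := mul_pos (inv_pos.2 (norm_pos_iff.2 hu)) (Real.rpow_pos_of_pos hq0 _)
  have hwx : ‖w‖ = x := by
    rw [hw, hx, norm_mul, norm_inv, Complex.norm_real,
      Real.norm_of_nonneg (Real.rpow_nonneg hq0.le _)]
  have hq1' : 0 < 1 - q := sub_pos.2 hq1
  have hpow (j : ℕ) : (u * ((q ^ (-lam) : ℝ) : ℂ)) ^ (j + 1) = w ^ (-((j : ℤ) + 1)) := by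
    have hinv : u * ((q ^ (-lam) : ℝ) : ℂ) = w⁻¹ := by
      rw [hw, Real.rpow_neg hq0.le, mul_inv, inv_inv, Complex.ofReal_inv]
    rw [hinv, zpow_neg, inv_pow]
    norm_cast
  set t : ℕ → ℝ := fun j => q ^ (((j : ℝ) + 1) ^ 2 / 2) * x ^ (-((j : ℤ) + 1)) with ht
  set c : ℕ → ℂ := fun j =>
    ((q ^ (((j : ℝ) + 1) ^ 2 / 2) : ℝ) : ℂ) * w ^ (-((j : ℤ) + 1)) with hc
  have hct (j : ℕ) : ‖c j‖ = t j := by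
    rw [hc, ht]
    simp only
    rw [norm_mul, norm_zpow, hwx, Complex.norm_real,
      Real.norm_of_nonneg (Real.rpow_nonneg hq0.le _)]
  have ht0 (j : ℕ) : 0 ≤ t j := hct j ▸ norm_nonneg _
  have hinj : Function.Injective fun j : ℕ => -((j : ℤ) + 1) := fun a b h => by
    simp only at h
    omega
  have hθ := summable_int_theta_term hx0 hq0 hq1
  have hcomp : (fun k : ℤ => q ^ ((k : ℝ) ^ 2 / 2) * x ^ k) ∘ (fun j : ℕ => -((j : ℤ) + 1)) = t := by
    funext j
    simp only [ht, Function.comp_apply]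
    push_cast
    rw [neg_sq]
  have hts : Summable t := hcomp ▸ hθ.comp_injective hinj
  have htθ : ∑' j, t j ≤ thetaR x q := by
    rw [← hcomp]
    exact tsum_comp_le_tsum_of_inj hθ (fun k => by positivity) hinj
  have hcs : Summable c := Summable.of_norm (by simpa only [hct] using hts)
  have hPb (j : ℕ) : ‖((P j : ℝ) : ℂ) - 1‖ ≤ q ^ (m + 2) / (1 - q) := by
    obtain ⟨hlo, hhi⟩ := qPochInfR_bounds (pow_nonneg hq0.le (m + j + 2))
      (pow_le_one₀ hq0.le hq1.le) hq0.le hq1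
    have hle : q ^ (m + j + 2) / (1 - q) ≤ q ^ (m + 2) / (1 - q) :=
      div_le_div_of_nonneg_right
        (pow_le_pow_of_le_one hq0.le hq1.le (by omega)) hq1'.le
    rw [← Complex.ofReal_one, ← Complex.ofReal_sub, Complex.norm_real, Real.norm_eq_abs, abs_le]
    constructor <;> simp only [hP] <;> linarith [div_nonneg (pow_nonneg hq0.le (m + 2)) hq1'.le]
  have hbound (j : ℕ) : ‖(((P j : ℝ) : ℂ) - 1) * c j‖ ≤ q ^ (m + 2) / (1 - q) * t j := by
    rw [norm_mul, hct]
    exact mul_le_mul_of_nonneg_right (hPb j) (ht0 j)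
  have hds : Summable fun j => (((P j : ℝ) : ℂ) - 1) * c j :=
    Summable.of_norm_bounded (hts.mul_left _) hbound
  refine ⟨∑' j, (((P j : ℝ) : ℂ) - 1) * c j, ?_, ?_⟩
  · rw [← hcs.tsum_add hds]
    refine tsum_congr fun j => ?_
    rw [hpow j]
    simp only [hc]
    ring
  · have hprod : 1 ≤ ∏' j : ℕ, (1 + q ^ (j + 3)) := by
      have hsum : Summable fun j : ℕ => q ^ (j + 3) :=
        (summable_nat_add_iff 3).2 (summable_geometric_of_lt_one hq0.le hq1)
      refine ge_of_tendsto'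
        (Real.multipliable_one_add_of_summable hsum).hasProd.tendsto_prod_nat fun n => ?_
      exact Finset.prod_const_one.symm.le.trans (Finset.prod_le_prod (fun _ _ => zero_le_one)
        fun j _ => le_add_of_nonneg_right (pow_nonneg hq0.le _))
    have hθ0 : 0 ≤ thetaR x q := (tsum_nonneg ht0).trans htθ
    calc ‖∑' j, (((P j : ℝ) : ℂ) - 1) * c j‖
        ≤ q ^ (m + 2) / (1 - q) * ∑' j, t j :=
          tsum_of_norm_bounded (hts.hasSum.mul_left _) hbound
      _ ≤ q ^ (m + 2) / (1 - q) * thetaR x q := by gcongr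
      _ = q ^ (m + 2) * 1 * thetaR x q / (1 - q) := by ring
      _ ≤ q ^ (m + 2) * (∏' j : ℕ, (1 + q ^ (j + 3))) * thetaR x q / (1 - q) := by gcongr
end
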